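/- (Compatibility of the potential ω: discrete versus discrete.) Let a_1, a_2, a_3 be nonzero complex numbers and let τ : ℤ³ × ℝ → ℂ be nowhere vanishing and smooth in x. Let φ be a smooth solution of the forward linear system with potential τ and ψ a smooth solution of the backward linear system with potential τ. Then for all i ≠ j in {1,2,3}, a_j((φψ_i)_j − φψ_i) = a_i((φψ_j)_i − φψ_j); in other words, the discrete defining relations Δ_iω = φψ_i (where Δ_i = a_i(T_i − 1)) for the potential ω(φ,ψ) are mutually compatible. -/

import Mathlib

noncomputable section

/-- Forward shift in the `i`-th discrete direction of `ℤ³`. -/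
def fwd (i : Fin 3) (n : Fin 3 → ℤ) : Fin 3 → ℤ := Function.update n i (n i + 1)

/-- Backward shift in the `i`-th discrete direction of `ℤ³`. -/
def bwd (i : Fin 3) (n : Fin 3 → ℤ) : Fin 3 → ℤ := Function.update n i (n i - 1)

/-- The semi-discrete KP equation:
`(a_i − a_j)(τ_{ij}τ − τ_i τ_j) + τ_{i,x} τ_j − τ_i τ_{j,x} = 0` for all `1 ≤ i < j ≤ 3`. -/
def SemiKP (a : Fin 3 → ℂ) (τ : (Fin 3 → ℤ) → ℝ → ℂ) : Prop :=
  ∀ i j : Fin 3, i < j → ∀ n x,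
    (a i - a j) * (τ (fwd i (fwd j n)) x * τ n x - τ (fwd i n) x * τ (fwd j n) x)
      + deriv (τ (fwd i n)) x * τ (fwd j n) x - τ (fwd i n) x * deriv (τ (fwd j n)) x = 0

/-- The forward linear system for `φ` with potential `τ`:
`a_i φ_i − a_j φ_j = (a_i − a_j)(τ_{ij}τ/(τ_i τ_j))φ` for `1 ≤ i < j ≤ 3`, together with
`φ_x = a_i φ_i + ((τ_x/τ)_i − τ_x/τ − a_i)φ` for `i = 1,2,3`. -/
def FwdLin (a : Fin 3 → ℂ) (τ φ : (Fin 3 → ℤ) → ℝ → ℂ) : Prop :=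
  (∀ i j : Fin 3, i < j → ∀ n x,
    a i * φ (fwd i n) x - a j * φ (fwd j n) x
      = (a i - a j) * (τ (fwd i (fwd j n)) x * τ n x / (τ (fwd i n) x * τ (fwd j n) x))
          * φ n x)
  ∧ ∀ i : Fin 3, ∀ n x,
      deriv (φ n) x = a i * φ (fwd i n) x
        + (deriv (τ (fwd i n)) x / τ (fwd i n) x - deriv (τ n) x / τ n x - a i) * φ n x

/-- The backward linear system for `ψ` with potential `τ`:
`a_i ψ_ī − a_j ψ_j̄ = (a_i − a_j)(τ_{īj̄}τ/(τ_ī τ_j̄))ψ` for `1 ≤ i < j ≤ 3`, together with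
`ψ_x = −a_i ψ_ī + ((τ_x/τ)_ī − τ_x/τ + a_i)ψ` for `i = 1,2,3`. -/
def BwdLin (a : Fin 3 → ℂ) (τ ψ : (Fin 3 → ℤ) → ℝ → ℂ) : Prop :=
  (∀ i j : Fin 3, i < j → ∀ n x,
    a i * ψ (bwd i n) x - a j * ψ (bwd j n) x
      = (a i - a j) * (τ (bwd i (bwd j n)) x * τ n x / (τ (bwd i n) x * τ (bwd j n) x))
          * ψ n x)
  ∧ ∀ i : Fin 3, ∀ n x,
      deriv (ψ n) x = -(a i) * ψ (bwd i n) x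
        + (deriv (τ (bwd i n)) x / τ (bwd i n) x - deriv (τ n) x / τ n x + a i) * ψ n x

theorem fwd_comm (i j : Fin 3) (n : Fin 3 → ℤ) : fwd i (fwd j n) = fwd j (fwd i n) := by
  rcases eq_or_ne i j with rfl | h
  · rfl
  · simp only [fwd, Function.update_of_ne h, Function.update_of_ne h.symm]
    exact Function.update_comm h.symm _ _ _

theorem bwd_fwd (i : Fin 3) (n : Fin 3 → ℤ) : bwd i (fwd i n) = n := by
  simp [fwd, bwd]

/-- The compatibility relation for directions in increasing order: both linear systems carry the
same coefficient, the forward one at `n` and the backward one at the doubly shifted point. -/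
theorem omega_compatibility_of_lt {a : Fin 3 → ℂ} {τ φ ψ : (Fin 3 → ℤ) → ℝ → ℂ}
    (hφ : FwdLin a τ φ) (hψ : BwdLin a τ ψ) {i j : Fin 3} (hij : i < j)
    (n : Fin 3 → ℤ) (x : ℝ) :
    a j * (φ (fwd j n) x * ψ (fwd i (fwd j n)) x - φ n x * ψ (fwd i n) x)
      = a i * (φ (fwd i n) x * ψ (fwd j (fwd i n)) x - φ n x * ψ (fwd j n) x) := by
  have hf := hφ.1 i j hij n x
  have hb := hψ.1 i j hij (fwd i (fwd j n)) x
  have hbj : bwd j (fwd i (fwd j n)) = fwd i n := by rw [fwd_comm, bwd_fwd]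
  rw [hbj, bwd_fwd, bwd_fwd, mul_comm (τ n x), mul_comm (τ (fwd j n) x)] at hb
  rw [fwd_comm j i]
  linear_combination φ n x * hb - ψ (fwd i (fwd j n)) x * hf

/-- Compatibility of the potential `ω`: discrete versus discrete. If `φ` solves the
forward and `ψ` the backward linear system with potential `τ`, then for all `i ≠ j`,
`a_j((φψ_i)_j − φψ_i) = a_i((φψ_j)_i − φψ_j)`, i.e. the discrete defining relations
`Δ_i ω = φ ψ_i` for the potential `ω(φ,ψ)` are mutually compatible. -/
theorem omega_compatibility_discrete_discrete
    (a : Fin 3 → ℂ) (ha : ∀ i, a i ≠ 0)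
    (τ φ ψ : (Fin 3 → ℤ) → ℝ → ℂ)
    (hτ0 : ∀ n x, τ n x ≠ 0)
    (hτsmooth : ∀ n, ContDiff ℝ (⊤ : ℕ∞) (τ n))
    (hφsmooth : ∀ n, ContDiff ℝ (⊤ : ℕ∞) (φ n))
    (hψsmooth : ∀ n, ContDiff ℝ (⊤ : ℕ∞) (ψ n))
    (hφ : FwdLin a τ φ) (hψ : BwdLin a τ ψ) :
    ∀ i j : Fin 3, i ≠ j → ∀ n x,
      a j * (φ (fwd j n) x * ψ (fwd i (fwd j n)) x - φ n x * ψ (fwd i n) x)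
        = a i * (φ (fwd i n) x * ψ (fwd j (fwd i n)) x - φ n x * ψ (fwd j n) x) := by
  intro i j hij n x
  rcases lt_or_gt_of_ne hij with h | h
  · exact omega_compatibility_of_lt hφ hψ h n x
  · exact (omega_compatibility_of_lt hφ hψ h n x).symm
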